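/- Let K be a field with char K = p > 0, and let 1 → H → G̃ → G → 1 be a group extension of finite groups, where H is a cyclic p-group. Then there exists a K-embedding ι : K(G) → K(G̃) such that K(G̃) is rational (purely transcendental) over the subfield ι(K(G)). -/

import Mathlib

set_option synthInstance.maxHeartbeats 1000000
set_option maxHeartbeats 1000000

noncomputable section

/-- The rational function field `K(x(g) : g ∈ G)` in variables indexed by `G`. -/
abbrev NoetherBigField (K : Type*) [Field K] (G : Type*) : Type _ :=
  FractionRing (MvPolynomial G K)

/-- The `K`-automorphism of `K(x(g) : g ∈ G)` induced by `h · x(g) = x(hg)`. -/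
def noetherAut (K : Type*) [Field K] (G : Type*) [Group G] (h : G) :
    NoetherBigField K G ≃ₐ[K] NoetherBigField K G :=
  IsFractionRing.algEquivOfAlgEquiv (MvPolynomial.renameEquiv K (Equiv.mulLeft h))

/-- The fixed field `K(G) = K(x(g) : g ∈ G)^G`, as a subfield. -/
def noetherSubfield (K : Type*) [Field K] (G : Type*) [Group G] :
    Subfield (NoetherBigField K G) where
  carrier := {x | ∀ h : G, noetherAut K G h x = x}
  mul_mem' := by intro a b ha hb h; rw [map_mul, ha h, hb h]
  one_mem' := by intro h; rw [map_one]
  add_mem' := by intro a b ha hb h; rw [map_add, ha h, hb h]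
  zero_mem' := by intro h; rw [map_zero]
  neg_mem' := by intro a ha h; rw [map_neg, ha h]
  inv_mem' := by intro a ha h; rw [map_inv₀, ha h]

/-- Noether's fixed field `K(G) = K(x(g) : g ∈ G)^G`. -/
def NoetherField (K : Type*) [Field K] (G : Type*) [Group G] : Type _ :=
  noetherSubfield K G

instance (K : Type*) [Field K] (G : Type*) [Group G] : Field (NoetherField K G) :=
  inferInstanceAs (Field (noetherSubfield K G))

theorem algebraMap_mem_noetherSubfield (K : Type*) [Field K] (G : Type*) [Group G] (c : K) :
    algebraMap K (NoetherBigField K G) c ∈ noetherSubfield K G := by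
  intro h
  exact AlgEquiv.commutes _ c

instance (K : Type*) [Field K] (G : Type*) [Group G] : Algebra K (NoetherField K G) :=
  RingHom.toAlgebra <|
    ((algebraMap K (NoetherBigField K G)).codRestrict (noetherSubfield K G).toSubring
      (algebraMap_mem_noetherSubfield K G))

/-- An extension `L/F` is rational (purely transcendental) if `L` is `F`-isomorphic to a
rational function field `F(t₁, …, tₙ)` over `F` in finitely many variables. -/
def IsRationalExtension (F L : Type*) [Field F] [Field L] [Algebra F L] : Prop :=
  ∃ n : ℕ, Nonempty (L ≃ₐ[F] FractionRing (MvPolynomial (Fin n) F))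

/-- An extension `L/F` is stably rational if the rational function field `L(y₁, …, y_r)`
is rational over `F` for some finite number `r` of indeterminates. -/
def IsStablyRationalExtension (F L : Type*) [Field F] [Field L] [Algebra F L] : Prop :=
  ∃ r : ℕ, IsRationalExtension F (FractionRing (MvPolynomial (Fin r) L))

section NN
variable {K E G : Type*} [Field K] [Field E] [Algebra K E] [Group G]

def nnFix (ρ : G →* (E ≃ₐ[K] E)) : IntermediateField K E where
  carrier := {x | ∀ g, ρ g x = x}
  mul_mem' := by intro a b ha hb h; rw [map_mul, ha h, hb h]
  add_mem' := by intro a b ha hb h; rw [map_add, ha h, hb h]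
  algebraMap_mem' := by intro r g; exact AlgEquiv.commutes _ r
  inv_mem' := by intro a ha h; rw [map_inv₀, ha h]

theorem mem_nnFix {ρ : G →* (E ≃ₐ[K] E)} {x : E} : x ∈ nnFix ρ ↔ ∀ g, ρ g x = x := Iff.rfl

variable [Finite G]

noncomputable def nnTr (ρ : G →* (E ≃ₐ[K] E)) (N : Subgroup G) (x : E) : E :=
  ∑ᶠ q : G ⧸ N, ρ q.out x

theorem nnTr_eq [Fintype G] (ρ : G →* (E ≃ₐ[K] E)) (N : Subgroup G) [Fintype (G ⧸ N)] (x : E) :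
    nnTr ρ N x = ∑ q : G ⧸ N, ρ q.out x := by
  unfold nnTr; rw [finsum_eq_sum_of_fintype]

theorem out_act (ρ : G →* (E ≃ₐ[K] E)) (N : Subgroup G) (x : E) (hx : ∀ g ∈ N, ρ g x = x) (g h : G)
    (hgh : (g : G ⧸ N) = h) : ρ g x = ρ h x := by
  have := hx _ (QuotientGroup.eq.1 hgh)
  have h2 : h = g * (g⁻¹ * h) := by group
  rw [h2, map_mul, AlgEquiv.mul_apply, this]

theorem nnTr_mem (ρ : G →* (E ≃ₐ[K] E)) (N : Subgroup G) (x : E) (hx : ∀ g ∈ N, ρ g x = x) :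
    nnTr ρ N x ∈ nnFix ρ := by
  classical
  cases nonempty_fintype G
  haveI : Fintype (G ⧸ N) := Fintype.ofFinite _
  intro g
  rw [nnTr_eq, map_sum]
  refine Fintype.sum_equiv (MulAction.toPerm g) _ _ ?_
  intro q
  rw [← AlgEquiv.mul_apply, ← map_mul]
  apply out_act ρ N x hx
  rw [MulAction.toPerm_apply, QuotientGroup.out_eq', ← smul_eq_mul, ← MulAction.Quotient.smul_coe,
    QuotientGroup.out_eq']

/-- indicator function -/
theorem nn_ind (ρ : G →* (E ≃ₐ[K] E)) (F : IntermediateField K E)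
    (hF : ∀ g, ∀ x ∈ F, ρ g x ∈ F) (N : Subgroup G)
    (hN : ∀ g ∈ N, ∀ x ∈ F, ρ g x = x) (hN' : ∀ g ∉ N, ∃ x ∈ F, ρ g x ≠ x) :
    ∃ f : (G ⧸ N) → E, f ∈ Submodule.span F (Set.range (fun (b : F) (q : G ⧸ N) => ρ q.out (b : E)))
      ∧ f ((1 : G) : G ⧸ N) = 1 ∧ ∀ q, q ≠ ((1 : G) : G ⧸ N) → f q = 0 := by
  classical
  cases nonempty_fintype G
  haveI : Fintype (G ⧸ N) := Fintype.ofFinite _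
  set one : G ⧸ N := ((1 : G) : G ⧸ N) with hone
  have h1N : one.out ∈ N := by
    have := QuotientGroup.out_eq' one
    have h := QuotientGroup.eq.1 (this.symm.trans rfl : ((1 : G) : G ⧸ N) = (one.out : G ⧸ N))
    simpa using h
  have hq : ∀ q : G ⧸ N, q ≠ one → ∃ x ∈ F, ρ q.out x ≠ x := by
    intro q hq
    apply hN'
    intro h
    apply hq
    rw [← QuotientGroup.out_eq' q, hone, eq_comm, QuotientGroup.eq]
    simpa using h
  choose! b hbF hb using hq
  let φ : F →* ((G ⧸ N) → E) :=
    { toFun := fun b q => ρ q.out (b : E)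
      map_one' := by ext q; simp
      map_mul' := by intro a b; ext q; simp }
  have hspan : Submodule.span F (Set.range (fun (b : F) (q : G ⧸ N) => ρ q.out (b : E)))
      = Subalgebra.toSubmodule (Algebra.adjoin F (Set.range φ)) := by
    rw [Algebra.adjoin_eq_span]
    congr 1
    have : (Set.range φ) = (MonoidHom.mrange φ : Set ((G ⧸ N) → E)) := by simp
    rw [this, Submonoid.closure_eq]; rfl
  rw [hspan]
  refine ⟨∏ q ∈ Finset.univ.erase one,
    (if h : q ≠ one then
    (algebraMap F ((G ⧸ N) → E) (⟨b q, hbF q h⟩ - ⟨ρ q.out (b q), hF _ _ (hbF q h)⟩)⁻¹) *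
      (φ ⟨b q, hbF q h⟩ - algebraMap F ((G ⧸ N) → E) ⟨ρ q.out (b q), hF _ _ (hbF q h)⟩) else 0), ?_, ?_, ?_⟩
  · rw [Subalgebra.mem_toSubmodule]
    refine Subalgebra.prod_mem _ fun q hq => ?_
    have h : q ≠ one := by simpa using hq
    rw [dif_pos h]
    refine mul_mem (Subalgebra.algebraMap_mem _ _) (sub_mem (Algebra.subset_adjoin ⟨_, rfl⟩) (Subalgebra.algebraMap_mem _ _))
  · rw [Finset.prod_apply]
    apply Finset.prod_eq_one
    intro q hq
    have h : q ≠ one := by simpa using hq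
    rw [dif_pos h]
    have : b q - ρ q.out (b q) ≠ 0 := sub_ne_zero.2 (hb q h).symm
    have h3 := hN _ h1N _ (hbF q h)
    simp only [Pi.mul_apply, Pi.algebraMap_apply, Pi.sub_apply]
    change (b q - ρ q.out (b q))⁻¹ * (ρ one.out (b q) - ρ q.out (b q)) = 1
    rw [h3, inv_mul_cancel₀ this]
  · intro q h
    rw [Finset.prod_apply]
    apply Finset.prod_eq_zero (i := q) (by simpa using h)
    rw [dif_pos h]
    simp only [Pi.mul_apply, Pi.algebraMap_apply, Pi.sub_apply]
    change (b q - ρ q.out (b q))⁻¹ * (ρ q.out (b q) - ρ q.out (b q)) = 0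
    rw [sub_self, mul_zero]

theorem nn_mem_span (ρ : G →* (E ≃ₐ[K] E)) (F : IntermediateField K E)
    (hF : ∀ g, ∀ x ∈ F, ρ g x ∈ F) (N : Subgroup G)
    (hN : ∀ g ∈ N, ∀ x ∈ F, ρ g x = x) (hN' : ∀ g ∉ N, ∃ x ∈ F, ρ g x ≠ x)
    (m : E) (hm : ∀ g ∈ N, ρ g m = m) :
    m ∈ Submodule.span F (Set.range (fun b : F => nnTr ρ N ((b : E) * m))) := by
  classical
  cases nonempty_fintype G
  haveI : Fintype (G ⧸ N) := Fintype.ofFinite _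
  obtain ⟨f, hf, h1, h0⟩ := nn_ind ρ F hF N hN hN'
  have key : ∀ f ∈ Submodule.span F (Set.range (fun (b : F) (q : G ⧸ N) => ρ q.out (b : E))),
      ∑ q : G ⧸ N, f q * ρ q.out m ∈ Submodule.span F (Set.range (fun b : F => nnTr ρ N ((b : E) * m))) := by
    intro f hf
    induction hf using Submodule.span_induction with
    | mem x h =>
      obtain ⟨b, rfl⟩ := h
      apply Submodule.subset_span
      refine ⟨b, ?_⟩
      simp only [nnTr_eq, map_mul]
    | zero => simp
    | add x y hx hy h1 h2 =>
      simp only [Pi.add_apply, add_mul, Finset.sum_add_distrib]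
      exact add_mem h1 h2
    | smul a x hx h =>
      have := Submodule.smul_mem _ a h
      simpa only [Finset.smul_sum, Pi.smul_apply, smul_mul_assoc] using this
  have := key f hf
  rw [Finset.sum_eq_single ((1 : G) : G ⧸ N) (fun q _ hq => by rw [h0 q hq, zero_mul]) (by simp),
    h1, one_mul] at this
  rw [out_act ρ N m hm _ 1 (QuotientGroup.out_eq' _), map_one] at this
  exact this

theorem nnTr_smul (ρ : G →* (E ≃ₐ[K] E)) (N : Subgroup G) (a x : E) (ha : a ∈ nnFix ρ) :
    nnTr ρ N (a * x) = a * nnTr ρ N x := by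
  classical
  cases nonempty_fintype G
  haveI : Fintype (G ⧸ N) := Fintype.ofFinite _
  simp only [nnTr_eq, map_mul, Finset.mul_sum]
  exact Finset.sum_congr rfl fun q _ => by rw [ha]

theorem nnTr_add (ρ : G →* (E ≃ₐ[K] E)) (N : Subgroup G) (a x : E) :
    nnTr ρ N (a + x) = nnTr ρ N a + nnTr ρ N x := by
  classical
  cases nonempty_fintype G
  haveI : Fintype (G ⧸ N) := Fintype.ofFinite _
  simp only [nnTr_eq, map_add, Finset.sum_add_distrib]

theorem nnTr_mem_of (ρ : G →* (E ≃ₐ[K] E)) (N : Subgroup G) {S : Type*} [SetLike S E] [AddSubmonoidClass S E] (M : S) (x : E)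
    (h : ∀ g, ρ g x ∈ M) :
    nnTr ρ N x ∈ M := by
  classical
  cases nonempty_fintype G
  haveI : Fintype (G ⧸ N) := Fintype.ofFinite _
  simp only [nnTr_eq]
  exact sum_mem fun q _ => h _

theorem nn_exists_tr_one (ρ : G →* (E ≃ₐ[K] E)) (F : IntermediateField K E)
    (hF : ∀ g, ∀ x ∈ F, ρ g x ∈ F) (N : Subgroup G)
    (hN : ∀ g ∈ N, ∀ x ∈ F, ρ g x = x) (hN' : ∀ g ∉ N, ∃ x ∈ F, ρ g x ≠ x) :
    ∃ t ∈ F, nnTr ρ N t = 1 := by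
  have h := nn_mem_span ρ F hF N hN hN' 1 (by simp)
  have : ∃ b ∈ F, nnTr ρ N b ≠ 0 := by
    by_contra! hcon
    have hz : Submodule.span F (Set.range (fun b : F => nnTr ρ N ((b : E) * 1))) = ⊥ := by
      rw [Submodule.span_eq_bot]
      rintro _ ⟨b, rfl⟩
      simpa using hcon b b.2
    rw [hz] at h
    simp at h
  obtain ⟨b, hb, h0⟩ := this
  have h1 : nnTr ρ N b ∈ nnFix ρ := nnTr_mem ρ N b fun g hg => hN g hg b hb
  have h2 : nnTr ρ N b ∈ F := nnTr_mem_of ρ N F b fun g => hF g b hb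
  refine ⟨(nnTr ρ N b)⁻¹ * b, mul_mem (inv_mem h2) hb, ?_⟩
  rw [nnTr_smul _ _ _ _ (inv_mem h1), inv_mul_cancel₀ h0]

/-- elements of a stable subfield are integral over the fixed part -/
theorem nn_integral (ρ : G →* (E ≃ₐ[K] E)) (F : IntermediateField K E)
    (hF : ∀ g, ∀ x ∈ F, ρ g x ∈ F) (x : E) (hx : x ∈ F) :
    IsIntegral (F ⊓ nnFix ρ : IntermediateField K E) x := by
  classical
  cases nonempty_fintype G
  let P : Polynomial E := ∏ g : G, (Polynomial.X - Polynomial.C (ρ g x))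
  have hP : P.Monic := Polynomial.monic_prod_of_monic _ _ fun g _ => Polynomial.monic_X_sub_C _
  have hl : P ∈ Polynomial.lifts (algebraMap (F ⊓ nnFix ρ : IntermediateField K E) E) := by
    rw [Polynomial.lifts_iff_coeff_lifts]
    intro n
    have : P.coeff n ∈ (F ⊓ nnFix ρ : IntermediateField K E) := by
      constructor
      · have h : P ∈ Polynomial.lifts (algebraMap F E) := by
          refine Subsemiring.prod_mem _ fun g _ => ?_
          have : (Polynomial.X - Polynomial.C (ρ g x)) = Polynomial.map (algebraMap F E) (Polynomial.X - Polynomial.C ⟨ρ g x, hF g x hx⟩) := by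
            simp
          rw [this, Polynomial.mem_lifts]
          exact ⟨_, rfl⟩
        rw [Polynomial.lifts_iff_coeff_lifts] at h
        obtain ⟨a, ha⟩ := h n
        rw [← ha]; exact a.2
      · intro g
        have : Polynomial.map (ρ g : E ≃ₐ[K] E).toRingEquiv.toRingHom P = P := by
          rw [Polynomial.map_prod]
          refine Fintype.prod_equiv (Equiv.mulLeft g) _ _ ?_
          intro h
          simp
        conv_rhs => rw [← this]
        rw [Polynomial.coeff_map]; rfl
    exact ⟨⟨_, this⟩, rfl⟩
  obtain ⟨Q, hQ, -, hQm⟩ := Polynomial.lifts_and_degree_eq_and_monic hl hP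
  refine ⟨Q, hQm, ?_⟩
  rw [← Polynomial.eval_map, hQ, Polynomial.eval_prod]
  apply Finset.prod_eq_zero (Finset.mem_univ (1 : G))
  simp

end NN

section NN
variable {K E G : Type*} [Field K] [Field E] [Algebra K E] [Group G]
variable [Finite G]

theorem nn_main (ρ : G →* (E ≃ₐ[K] E)) (F : IntermediateField K E)
    (hF : ∀ g, ∀ x ∈ F, ρ g x ∈ F) (N : Subgroup G)
    (hN : ∀ g ∈ N, ∀ x ∈ F, ρ g x = x) (hN' : ∀ g ∉ N, ∃ x ∈ F, ρ g x ≠ x)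
    (T : Finset E) (hT : ∀ g, ∀ t ∈ T, ρ g t ∈ Submodule.span F (insert (1 : E) (T : Set E)))
    (hNT : ∀ g ∈ N, ∀ t ∈ T, ρ g t = t) :
    ∃ S : Finset E, S.card ≤ T.card ∧ (∀ s ∈ S, s ∈ nnFix ρ) ∧
      (F ⊔ IntermediateField.adjoin K (T : Set E)) ⊓ nnFix ρ ≤
        (F ⊓ nnFix ρ) ⊔ IntermediateField.adjoin K (S : Set E) := by
  classical
  set M := Submodule.span F (insert (1 : E) (T : Set E)) with hM
  have h1M : (1 : E) ∈ M := Submodule.subset_span (Set.mem_insert _ _)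
  have hstab : ∀ g, ∀ t ∈ insert (1 : E) (T : Set E), ρ g t ∈ M := by
    rintro g t (rfl | ht)
    · simpa using h1M
    · exact hT g t ht
  have hfix : ∀ g ∈ N, ∀ t ∈ insert (1 : E) (T : Set E), ρ g t = t := by
    rintro g hg t (rfl | ht)
    · simp
    · exact hNT g hg t ht
  let W : Set E := {x | x ∈ M ∧ x ∈ nnFix ρ}
  have hTW : ∀ t ∈ insert (1 : E) (T : Set E), t ∈ Submodule.span F W := by
    intro t ht
    refine Submodule.span_mono ?_ (nn_mem_span ρ F hF N hN hN' t fun g hg => hfix g hg t ht)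
    rintro _ ⟨b, rfl⟩
    constructor
    · apply nnTr_mem_of
      intro g
      rw [map_mul]
      exact M.smul_mem ⟨ρ g b, hF g b b.2⟩ (hstab g t ht)
    · apply nnTr_mem
      intro g hg
      rw [map_mul, hfix g hg t ht, hN g hg b b.2]
  have h1W : ({1} : Set E) ⊆ W := by
    rintro _ rfl
    exact ⟨h1M, one_mem _⟩
  have hli : LinearIndepOn F id ({1} : Set E) := LinearIndepOn.singleton (by simp)
  obtain ⟨b, hbW, h1b, hWb, hbli⟩ := exists_linearIndepOn_id_extension hli h1W
  have hMb : M ≤ Submodule.span F b := by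
    rw [hM, Submodule.span_le]
    intro t ht
    have := hTW t ht
    exact (Submodule.span_le.2 hWb) this
  have hfinM : (insert (1 : E) (T : Set E)) = ((insert 1 T : Finset E) : Set E) := by simp
  haveI : Module.Finite F M := by
    rw [hM, hfinM]; infer_instance
  have hbM : b ⊆ M := fun x hx => (hbW hx).1
  have hli2 : LinearIndependent F (fun x : b => (⟨x, hbM x.2⟩ : M)) := by
    apply LinearIndependent.of_comp M.subtype
    exact hbli
  haveI : Finite b := hli2.finite
  have hbfin : b.Finite := Set.toFinite b
  have hcard : hbfin.toFinset.card ≤ T.card + 1 := by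
    haveI := Fintype.ofFinite b
    have h := hli2.fintype_card_le_finrank
    have h2 : Module.finrank F M ≤ (insert 1 T : Finset E).card := by
      rw [hM, hfinM]; exact finrank_span_finset_le_card _
    have h3 := Finset.card_insert_le (1 : E) T
    have h4 : hbfin.toFinset.card = Fintype.card b := by
      rw [← Set.ncard_eq_toFinset_card b hbfin, Set.ncard_eq_toFinset_card', Set.toFinset_card]
    omega
  refine ⟨hbfin.toFinset.erase 1, ?_, ?_, ?_⟩
  · rw [Finset.card_erase_of_mem (by simpa using h1b)]
    omega
  · intro s hs
    have : s ∈ b := by simpa using (Finset.mem_erase.1 hs).2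
    exact (hbW this).2
  · set S := hbfin.toFinset.erase 1
    set Q := (F ⊓ nnFix ρ) ⊔ IntermediateField.adjoin K (S : Set E) with hQ
    have hSQ : ∀ s ∈ b, s ∈ Q := by
      intro s hs
      by_cases h : s = 1
      · rw [h]; exact one_mem _
      · exact (le_sup_right : _ ≤ Q) (IntermediateField.subset_adjoin K _ (by simp [S, h, hs]))
    have hQF : Q ≤ nnFix ρ := by
      refine sup_le inf_le_right ?_
      rw [IntermediateField.adjoin_le_iff]
      intro s hs
      have : s ∈ b := by simpa using (Finset.mem_erase.1 hs).2
      exact (hbW this).2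
    let R : IntermediateField Q E := IntermediateField.adjoin Q (F : Set E)
    have hFR : F ≤ R.restrictScalars K := fun x hx => IntermediateField.subset_adjoin Q _ hx
    have hle : F ⊔ IntermediateField.adjoin K (T : Set E) ≤ R.restrictScalars K := by
      refine sup_le hFR ?_
      rw [IntermediateField.adjoin_le_iff]
      intro t ht
      have h := hMb (Submodule.subset_span (Set.mem_insert_of_mem 1 ht))
      clear ht
      induction h using Submodule.span_induction with
      | mem x h => exact R.algebraMap_mem ⟨x, hSQ x h⟩
      | zero => exact zero_mem _
      | add x y _ _ h1 h2 => exact add_mem h1 h2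
      | smul a x _ h =>
        exact mul_mem (hFR a.2) h
    rintro e ⟨he, hefix⟩
    have heR : e ∈ R := hle he
    have halg : ∀ x ∈ (F : Set E), IsAlgebraic Q x := by
      intro x hx
      have h := nn_integral ρ F hF x hx
      have hle : F ⊓ nnFix ρ ≤ Q := le_sup_left
      letI := (IntermediateField.inclusion hle).toRingHom.toAlgebra
      haveI : IsScalarTower (F ⊓ nnFix ρ : IntermediateField K E) Q E := IsScalarTower.of_algebraMap_eq fun x => rfl
      exact h.tower_top.isAlgebraic
    have heR' : e ∈ Submodule.span Q (F : Set E) := by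
      have h1 : e ∈ R.toSubalgebra := heR
      rw [IntermediateField.adjoin_toSubalgebra_of_isAlgebraic halg, ← Subalgebra.mem_toSubmodule, Algebra.adjoin_eq_span] at h1
      have : Submonoid.closure (F : Set E) = F.toSubalgebra.toSubmonoid := Submonoid.closure_eq F.toSubalgebra.toSubmonoid
      rw [this] at h1
      exact h1
    obtain ⟨t, htF, ht⟩ := nn_exists_tr_one ρ F hF N hN hN'
    have key : ∀ x ∈ Submodule.span Q (F : Set E), nnTr ρ N (x * t) ∈ Q := by
      intro x hx
      induction hx using Submodule.span_induction with
      | mem x h =>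
        refine (le_sup_left : _ ≤ Q) ⟨nnTr_mem_of ρ N F _ fun g => hF g _ (mul_mem h htF), ?_⟩
        exact nnTr_mem ρ N _ fun g hg => hN g hg _ (mul_mem h htF)
      | zero =>
        rw [zero_mul]
        have := nnTr_smul ρ N 0 0 (zero_mem _)
        rw [zero_mul, zero_mul] at this
        rw [this]; exact zero_mem _
      | add x y _ _ h1 h2 => rw [add_mul, nnTr_add]; exact add_mem h1 h2
      | smul a x _ h =>
        have : (a • x) * t = (a : E) * (x * t) := by rw [← mul_assoc]; rfl
        rw [this, nnTr_smul _ _ _ _ (hQF a.2)]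
        exact mul_mem a.2 h
    have := key e heR'
    rwa [nnTr_smul _ _ _ _ hefix, ht, mul_one] at this

end NN

section NN
variable {K E G : Type*} [Field K] [Field E] [Algebra K E] [Group G]

theorem natCast_frob (p : ℕ) [Fact p.Prime] [CharP E p] (n : ℕ) : (n : E) ^ p = n := by
  have := map_natCast (frobenius E p) n
  rwa [frobenius_def] at this

open Polynomial in
theorem as_aux (ρ : G →* (E ≃ₐ[K] E)) (p : ℕ) [Fact p.Prime] [CharP E p] (P : IntermediateField K E)
    (u : E) (h0 : G) (hP : ∀ x ∈ P, ρ h0 x = x) (hu : ρ h0 u = u + 1)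
    (hz : u ^ p - u ∈ P) (e : E) (he : e ∈ P ⊔ IntermediateField.adjoin K {u}) (hfix : ρ h0 e = e) :
    e ∈ P := by
  have hp1 : 1 < p := (Fact.out : p.Prime).one_lt
  let Q : Polynomial P := X ^ p - (X + C ⟨_, hz⟩)
  have hdeg : (X + C (⟨_, hz⟩ : P) : Polynomial P).degree < (p : WithBot ℕ) := by
    rw [degree_X_add_C]; exact_mod_cast hp1
  have hQm : Q.Monic := monic_X_pow_sub (n := p) hdeg
  have hQd : Q.natDegree = p := by
    have h1 : Q.degree = (p : WithBot ℕ) := by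
      rw [degree_sub_eq_left_of_degree_lt]
      · simp
      · simpa using hdeg
    exact natDegree_eq_of_degree_eq_some h1
  have hQu : aeval u Q = 0 := by
    simp only [Q, map_sub, map_add, map_pow, aeval_X, aeval_C]
    change u ^ p - (u + (u ^ p - u)) = 0
    ring
  have hint : IsIntegral P u := ⟨Q, hQm, hQu⟩
  have he' : e ∈ IntermediateField.adjoin P {u} := by
    have hle : P ⊔ IntermediateField.adjoin K {u} ≤ (IntermediateField.adjoin P {u}).restrictScalars K := by
      refine sup_le ?_ ?_
      · intro x hx
        exact (IntermediateField.adjoin P {u}).algebraMap_mem ⟨x, hx⟩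
      · rw [IntermediateField.adjoin_le_iff]
        rintro _ rfl
        exact IntermediateField.subset_adjoin P _ rfl
    exact hle he
  have he2 : e ∈ (IntermediateField.adjoin P {u}).toSubalgebra := he'
  rw [IntermediateField.adjoin_simple_toSubalgebra_of_isAlgebraic hint.isAlgebraic,
    Algebra.adjoin_singleton_eq_range_aeval] at he2
  obtain ⟨f, hf⟩ := he2
  change aeval u f = e at hf
  let r := f %ₘ Q
  have hr : aeval u r = e := by
    rw [← hf, ← modByMonic_add_div f Q]
    simp [hQu, r]
  have hrd : r.natDegree < p := by
    rw [← hQd]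
    refine natDegree_modByMonic_lt f hQm ?_
    intro h
    rw [h] at hQd; simp at hQd; omega
  have hstep : ∀ j : ℕ, aeval (u + j) r = e := by
    intro j
    induction j with
    | zero => simpa using hr
    | succ j ih =>
      have h1 : ∀ f : Polynomial P, ρ h0 (aeval (u + j) f) = aeval (u + (j + 1 : ℕ)) f := by
        intro f
        induction f using Polynomial.induction_on' with
        | add a b ha hb => simp only [map_add, ha, hb]
        | monomial n a =>
          simp only [aeval_monomial, map_mul, map_pow, map_add, map_natCast, hu]
          have : ρ h0 (algebraMap P E a) = algebraMap P E a := hP a a.2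
          rw [this]
          push_cast
          ring
      rw [← h1, ih, hfix]
  let R : Polynomial E := r.map (algebraMap P E) - C e
  have hR : R = 0 := by
    refine eq_zero_of_natDegree_lt_card_of_eval_eq_zero R (ι := Fin p) (f := fun j => u + (j : ℕ)) ?_ ?_ ?_
    · intro a b hab
      have : ((a : ℕ) : E) = (b : ℕ) := by simpa using hab
      rw [CharP.natCast_eq_natCast E p] at this
      exact Fin.ext (Nat.ModEq.eq_of_lt_of_lt this a.2 b.2)
    · intro j
      have := hstep j
      simp only [R, eval_sub, eval_C, eval_map_algebraMap, this, sub_self]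
    · rw [Fintype.card_fin]
      refine lt_of_le_of_lt (natDegree_sub_C).le ?_
      exact lt_of_le_of_lt natDegree_map_le hrd
  have hc : R.coeff 0 = 0 := by rw [hR]; simp
  simp only [R, coeff_sub, coeff_map, coeff_C_zero, sub_eq_zero] at hc
  rw [← hc]
  exact (r.coeff 0).2

theorem as_main [Finite G] (ρ : G →* (E ≃ₐ[K] E)) (p : ℕ) [Fact p.Prime] [CharP E p] (L : IntermediateField K E)
    (hL : ∀ g, ∀ x ∈ L, ρ g x ∈ L) (N : Subgroup G)
    (hN : ∀ g ∈ N, ∀ x ∈ L, ρ g x = x) (hN' : ∀ g ∉ N, ∃ x ∈ L, ρ g x ≠ x)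
    (u : E) (hu : ∀ g, ∃ n : ℕ, ρ g u - n * u ∈ L) (hNu : ∀ g ∈ N, ∃ n : ℕ, ρ g u = u + n)
    (h0 : G) (h0N : h0 ∈ N) (h0u : ρ h0 u = u + 1) :
    ∃ S : Finset E, S.card ≤ 1 ∧ (∀ s ∈ S, s ∈ nnFix ρ) ∧
      (L ⊔ IntermediateField.adjoin K {u}) ⊓ nnFix ρ ≤
        (L ⊓ nnFix ρ) ⊔ IntermediateField.adjoin K (S : Set E) := by
  have hzN : ∀ g ∈ N, ρ g (u ^ p - u) = u ^ p - u := by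
    intro g hg
    obtain ⟨n, hn⟩ := hNu g hg
    rw [map_sub, map_pow, hn, add_pow_char, natCast_frob]
    ring
  obtain ⟨S, hS, hSf, hle⟩ := nn_main ρ L hL N hN hN' {u ^ p - u} (by
    intro g t ht
    obtain rfl := Finset.mem_singleton.1 ht
    obtain ⟨n, hn⟩ := hu g
    set a := ρ g u - n * u with ha
    have h1 : ρ g u = n * u + a := by rw [ha]; ring
    have h2 : ρ g (u ^ p - u) = n * (u ^ p - u) + (a ^ p - a) * 1 := by
      rw [map_sub, map_pow, h1, add_pow_char, mul_pow, natCast_frob]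
      ring
    rw [h2]
    refine add_mem ?_ ?_
    · exact Submodule.smul_mem _ (n : L) (Submodule.subset_span (by simp))
    · exact Submodule.smul_mem _ (⟨a ^ p - a, sub_mem (pow_mem hn p) hn⟩ : L) (Submodule.subset_span (by simp))) (by
    intro g hg t ht
    obtain rfl := Finset.mem_singleton.1 ht
    exact hzN g hg)
  refine ⟨S, by simpa using hS, hSf, le_trans (le_inf ?_ inf_le_right) hle⟩
  rintro e ⟨he, hef⟩
  refine as_aux ρ p _ u h0 ?_ h0u ?_ e ?_ (hef h0)
  · intro x hx
    have hle2 : L ⊔ IntermediateField.adjoin K (({u ^ p - u} : Finset E) : Set E) ≤ nnFix (ρ.comp (Subgroup.zpowers h0).subtype) := by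
      have hz : ∀ g : Subgroup.zpowers h0, (g : G) ∈ N := fun g => (Subgroup.zpowers_le.2 h0N) g.2
      refine sup_le ?_ ?_
      · intro x hx g
        exact hN _ (hz g) x hx
      · rw [IntermediateField.adjoin_le_iff]
        intro x hx g
        obtain rfl := Finset.mem_singleton.1 hx
        exact hzN _ (hz g)
    exact hle2 hx ⟨h0, Subgroup.mem_zpowers h0⟩
  · exact (le_sup_right : _ ≤ L ⊔ _) (IntermediateField.subset_adjoin K _ (by simp))
  · exact (sup_le_sup_right le_sup_left _ : L ⊔ IntermediateField.adjoin K {u} ≤ _) he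

end NN

noncomputable section

section NC
variable (K : Type*) [Field K]

def nx {G : Type*} (g : G) : NoetherBigField K G := algebraMap (MvPolynomial G K) _ (MvPolynomial.X g)

theorem nx_adjoin (G : Type*) : IntermediateField.adjoin K (Set.range (nx K : G → NoetherBigField K G)) = ⊤ := by
  rw [eq_top_iff]
  rintro x -
  have key : ∀ a : MvPolynomial G K, algebraMap (MvPolynomial G K) (NoetherBigField K G) a ∈
      IntermediateField.adjoin K (Set.range (nx K : G → NoetherBigField K G)) := by
    intro a
    induction a using MvPolynomial.induction_on with
    | C a =>
      have : algebraMap (MvPolynomial G K) (NoetherBigField K G) (MvPolynomial.C a) = algebraMap K _ a := by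
        rw [← MvPolynomial.algebraMap_eq, ← IsScalarTower.algebraMap_apply]
      rw [this]
      exact IntermediateField.algebraMap_mem _ _
    | add p q hp hq => rw [map_add]; exact add_mem hp hq
    | mul_X p n hp => rw [map_mul]; exact mul_mem hp (IntermediateField.subset_adjoin K _ ⟨n, rfl⟩)
  obtain ⟨a, b, hb, rfl⟩ := IsFractionRing.div_surjective (A := MvPolynomial G K) x
  exact div_mem (key a) (key b)

theorem nx_ext {G A : Type*} [Field A] [Algebra K A] {f f' : NoetherBigField K G →ₐ[K] A}
    (h : ∀ g, f (nx K g) = f' (nx K g)) : f = f' := by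
  refine AlgHom.ext fun x => ?_
  have hx : x ∈ IntermediateField.adjoin K (Set.range (nx K : G → NoetherBigField K G)) := by
    rw [nx_adjoin]; trivial
  induction hx using IntermediateField.adjoin_induction with
  | mem x hx => obtain ⟨g, rfl⟩ := hx; exact h g
  | algebraMap a => simp
  | add x y _ _ h1 h2 => simp only [map_add, h1, h2]
  | inv x _ h => simp only [map_inv₀, h]
  | mul x y _ _ h1 h2 => simp only [map_mul, h1, h2]

theorem noetherAut_nx {G : Type*} [Group G] (h g : G) : noetherAut K G h (nx K g) = nx K (h * g) := by
  unfold noetherAut nx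
  rw [IsFractionRing.algEquivOfAlgEquiv_algebraMap]
  simp

def nrho (G : Type*) [Group G] : G →* (NoetherBigField K G ≃ₐ[K] NoetherBigField K G) where
  toFun := noetherAut K G
  map_one' := by
    ext x
    have : (noetherAut K G 1 : NoetherBigField K G →ₐ[K] NoetherBigField K G) = AlgHom.id K _ := by
      apply nx_ext
      intro g
      simp [noetherAut_nx]
    exact DFunLike.congr_fun this x
  map_mul' := by
    intro a b
    ext x
    have : (noetherAut K G (a * b) : NoetherBigField K G →ₐ[K] NoetherBigField K G) =
      (noetherAut K G a : NoetherBigField K G →ₐ[K] NoetherBigField K G).comp (noetherAut K G b : NoetherBigField K G →ₐ[K] NoetherBigField K G) := by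
      apply nx_ext
      intro g
      simp [noetherAut_nx, mul_assoc]
    exact DFunLike.congr_fun this x

theorem nrho_nx {G : Type*} [Group G] (h g : G) : nrho K G h (nx K g) = nx K (h * g) := noetherAut_nx K h g

variable {Gt G : Type*} [Group Gt] [Group G] [Fintype Gt] [DecidableEq G]

def npoly (π : Gt →* G) : MvPolynomial G K →ₐ[K] MvPolynomial Gt K :=
  MvPolynomial.aeval fun g => ∑ a : Gt with π a = g, MvPolynomial.X a

theorem npoly_inj (π : Gt →* G) (hs : Function.Surjective π) : Function.Injective (npoly K π) := by
  classical
  choose s hs using hs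
  let r : MvPolynomial Gt K →ₐ[K] MvPolynomial G K :=
    MvPolynomial.aeval fun a => if a = s (π a) then MvPolynomial.X (π a) else 0
  have : r.comp (npoly K π) = AlgHom.id K _ := by
    apply MvPolynomial.algHom_ext
    intro g
    simp only [npoly, r, AlgHom.comp_apply, MvPolynomial.aeval_X, map_sum, AlgHom.id_apply]
    rw [Finset.sum_eq_single (s g)]
    · simp [hs]
    · intro b hb hne
      have : π b = g := by simpa using hb
      rw [this, if_neg hne]
    · intro h; exact absurd (by simp [hs]) h
  intro a b hab
  have h2 := congrArg r hab
  have h3 := fun x => DFunLike.congr_fun this x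
  simp only [AlgHom.comp_apply, AlgHom.id_apply] at h3
  rwa [h3, h3] at h2

theorem npoly_inj' (π : Gt →* G) (hs : Function.Surjective π) : Function.Injective
    ((IsScalarTower.toAlgHom K (MvPolynomial Gt K) (NoetherBigField K Gt)).comp (npoly K π)) :=
  (IsFractionRing.injective (MvPolynomial Gt K) (NoetherBigField K Gt)).comp (npoly_inj K π hs)

def npull (π : Gt →* G) (hs : Function.Surjective π) : NoetherBigField K G →ₐ[K] NoetherBigField K Gt :=
  IsFractionRing.liftAlgHom (A := MvPolynomial G K)
    (g := (IsScalarTower.toAlgHom K (MvPolynomial Gt K) (NoetherBigField K Gt)).comp (npoly K π))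
    (npoly_inj' K π hs)

theorem npull_nx (π : Gt →* G) (hs : Function.Surjective π) (g : G) :
    npull K π hs (nx K g) = ∑ a : Gt with π a = g, nx K a := by
  unfold npull nx
  rw [IsFractionRing.liftAlgHom_apply, IsFractionRing.lift_algebraMap]
  simp [npoly]

theorem npull_equivariant (π : Gt →* G) (hs : Function.Surjective π) (k : Gt) (x : NoetherBigField K G) :
    nrho K Gt k (npull K π hs x) = npull K π hs (nrho K G (π k) x) := by
  have : (nrho K Gt k : NoetherBigField K Gt →ₐ[K] NoetherBigField K Gt).comp (npull K π hs) =
    (npull K π hs).comp (nrho K G (π k) : NoetherBigField K G →ₐ[K] NoetherBigField K G) := by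
    apply nx_ext
    intro g
    change nrho K Gt k (npull K π hs (nx K g)) = npull K π hs (nrho K G (π k) (nx K g))
    simp only [nrho_nx, npull_nx, map_sum]
    refine Finset.sum_equiv (Equiv.mulLeft k) ?_ ?_
    · intro i; simp
    · intro i _; rfl
  exact DFunLike.congr_fun this x

end NC

section NV
variable (K : Type*) [Field K]

def nval (G : Type*) [Group G] : NoetherField K G →ₐ[K] NoetherBigField K G where
  toFun := fun x => (x : noetherSubfield K G).1
  map_one' := rfl
  map_mul' := fun _ _ => rfl
  map_zero' := rfl
  map_add' := fun _ _ => rfl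
  commutes' := fun _ => rfl

theorem nval_mem {G : Type*} [Group G] (x : NoetherField K G) : nval K G x ∈ nnFix (nrho K G) :=
  fun g => (x : noetherSubfield K G).2 g

def nmk {G : Type*} [Group G] (x : NoetherBigField K G) (hx : x ∈ nnFix (nrho K G)) : NoetherField K G :=
  (⟨x, hx⟩ : noetherSubfield K G)

theorem nval_nmk {G : Type*} [Group G] (x : NoetherBigField K G) (hx : x ∈ nnFix (nrho K G)) :
   nval K G (nmk K x hx) = x := rfl

theorem nval_inj (G : Type*) [Group G] : Function.Injective (nval K G) := (nval K G).injective

def NP (Gt G : Type*) [Group Gt] [Group G] : Prop :=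
  ∃ ι : NoetherField K G →ₐ[K] NoetherField K Gt, ∃ S : Finset (NoetherField K Gt),
    S.card + Nat.card G ≤ Nat.card Gt ∧ IntermediateField.adjoin K (Set.range ι ∪ S) = ⊤

theorem nlift_mem {Gt G : Type*} [Group Gt] [Group G] [Fintype Gt] [DecidableEq G]
    (π : Gt →* G) (hs : Function.Surjective π) (x : NoetherField K G) :
    npull K π hs (nval K G x) ∈ nnFix (nrho K Gt) := by
  intro k
  rw [npull_equivariant, nval_mem]

def nlift {Gt G : Type*} [Group Gt] [Group G] [Fintype Gt] [DecidableEq G]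
    (π : Gt →* G) (hs : Function.Surjective π) : NoetherField K G →ₐ[K] NoetherField K Gt where
  toFun := fun x => nmk K (npull K π hs (nval K G x)) (nlift_mem K π hs x)
  map_one' := by apply nval_inj; rw [nval_nmk, map_one, map_one, map_one]
  map_mul' := by intro x y; apply nval_inj; rw [nval_nmk, map_mul, map_mul, map_mul]; rfl
  map_zero' := by apply nval_inj; rw [nval_nmk, map_zero, map_zero, map_zero]
  map_add' := by intro x y; apply nval_inj; rw [nval_nmk, map_add, map_add, map_add]; rfl
  commutes' := by intro x; apply nval_inj; rw [nval_nmk, AlgHom.commutes, AlgHom.commutes, AlgHom.commutes]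

theorem nval_nlift {Gt G : Type*} [Group Gt] [Group G] [Fintype Gt] [DecidableEq G]
    (π : Gt →* G) (hs : Function.Surjective π) (x : NoetherField K G) :
    nval K Gt (nlift K π hs x) = npull K π hs (nval K G x) := rfl

variable {K} in
theorem adjoin_eq_top_of_map {B E : Type*} [Field B] [Field E] [Algebra K B] [Algebra K E] (v : B →ₐ[K] E)
    (X : Set B) (h : ∀ b, v b ∈ IntermediateField.adjoin K (v '' X)) :
    IntermediateField.adjoin K X = ⊤ := by
  rw [eq_top_iff]
  rintro b -
  have := h b
  rw [← IntermediateField.adjoin_map] at this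
  obtain ⟨c, hc, hcb⟩ := this
  rw [← v.injective hcb]
  exact hc

theorem NP_mk {Gt G : Type*} [Group Gt] [Group G] [Fintype Gt] [DecidableEq G]
    (π : Gt →* G) (hs : Function.Surjective π) (S : Finset (NoetherBigField K Gt))
    (hcard : S.card + Nat.card G ≤ Nat.card Gt)
    (hS : ∀ s ∈ S, s ∈ nnFix (nrho K Gt))
    (hle : nnFix (nrho K Gt) ≤ ((npull K π hs).fieldRange ⊓ nnFix (nrho K Gt)) ⊔ IntermediateField.adjoin K (S : Set _)) :
    NP K Gt G := by
  classical
  let S' : Finset (NoetherField K Gt) := S.attach.image fun (s : {x // x ∈ S}) => nmk (G := Gt) K (s : NoetherBigField K Gt) (hS (s : NoetherBigField K Gt) s.property)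
  refine ⟨nlift K π hs, S', ?_, ?_⟩
  · have : S'.card ≤ S.card := Finset.card_image_le.trans (by simp)
    omega
  · refine adjoin_eq_top_of_map (nval K Gt) _ ?_
    intro b
    refine (hle.trans (sup_le ?_ ?_)) (nval_mem K b)
    · intro y hy
      obtain ⟨hy1, hy2⟩ := IntermediateField.mem_inf.1 hy
      obtain ⟨x, hx⟩ := AlgHom.mem_fieldRange.1 hy1
      have hx' : x ∈ nnFix (nrho K G) := by
        rw [mem_nnFix]
        intro g
        obtain ⟨k, rfl⟩ := hs g
        apply (npull K π hs).injective
        change npull K π hs (nrho K G (π k) x) = npull K π hs x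
        rw [← npull_equivariant, hx, mem_nnFix.1 hy2 k]
      apply IntermediateField.subset_adjoin
      refine ⟨nlift K π hs (nmk K x hx'), Or.inl ⟨_, rfl⟩, ?_⟩
      rw [nval_nlift, nval_nmk, hx]
    · rw [IntermediateField.adjoin_le_iff]
      intro s hs'
      apply IntermediateField.subset_adjoin
      refine ⟨nmk K s (hS s hs'), Or.inr ?_, nval_nmk K _ _⟩
      rw [Finset.mem_coe, Finset.mem_image]
      exact ⟨⟨s, hs'⟩, Finset.mem_attach _ _, rfl⟩

theorem NP_trans {G₁ G₂ G₃ : Type*} [Group G₁] [Group G₂] [Group G₃]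
    (h12 : NP K G₁ G₂) (h23 : NP K G₂ G₃) : NP K G₁ G₃ := by
  classical
  obtain ⟨ι, S, hc, hS⟩ := h12
  obtain ⟨ι', S', hc', hS'⟩ := h23
  refine ⟨ι.comp ι', S ∪ S'.image ι, ?_, ?_⟩
  · have := Finset.card_union_le S (S'.image ι)
    have := Finset.card_image_le (s := S') (f := ι)
    omega
  · rw [eq_top_iff, ← hS, IntermediateField.adjoin_le_iff]
    rintro x (⟨y, rfl⟩ | hx)
    · have hy : y ∈ IntermediateField.adjoin K (Set.range ι' ∪ S') := by rw [hS']; trivial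
      have : ι y ∈ (IntermediateField.adjoin K (Set.range ι' ∪ S')).map ι := ⟨y, hy, rfl⟩
      rw [IntermediateField.adjoin_map] at this
      refine IntermediateField.adjoin.mono K _ _ ?_ this
      rintro _ ⟨z, (⟨w, rfl⟩ | hz), rfl⟩
      · exact Or.inl ⟨w, rfl⟩
      · refine Or.inr ?_
        simp only [Finset.coe_union, Finset.coe_image]
        exact Or.inr ⟨z, hz, rfl⟩
    · refine IntermediateField.subset_adjoin K _ (Or.inr ?_)
      simp only [Finset.coe_union]
      exact Or.inl hx

end NV
end

noncomputable section
section FF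
open Cardinal
universe uK uA uB uG

theorem rational_of_gen {K : Type uK} {A : Type uA} {B : Type uB} [Field K] [Field A] [Field B] [Algebra K A] [Algebra K B]
    [Algebra A B] [IsScalarTower K A B] (S : Finset B) (hS : IntermediateField.adjoin A (S : Set B) = ⊤)
    (m n : ℕ) (hA : Algebra.trdeg K A = m) (hB : Algebra.trdeg K B = n) (hmn : S.card + m ≤ n) :
    IsRationalExtension A B := by
  have h := lift_trdeg_add_eq K A B
  rw [hA, hB] at h
  let x : Fin S.card → B := fun i => (S.equivFin.symm i : B)
  have hx : Set.range x = S := by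
    ext b
    constructor
    · rintro ⟨i, rfl⟩; exact (S.equivFin.symm i).2
    · intro hb; exact ⟨S.equivFin ⟨b, hb⟩, by simp [x]⟩
  have halg : Algebra.IsAlgebraic (Algebra.adjoin A (Set.range x)) B := by
    constructor
    intro b
    have hb : b ∈ IntermediateField.adjoin A (S : Set B) := by rw [hS]; trivial
    rw [← hx, IntermediateField.mem_adjoin_iff_div] at hb
    obtain ⟨r, hr, s, hs, rfl⟩ := hb
    rw [div_eq_mul_inv]
    exact (isAlgebraic_algebraMap (⟨r, hr⟩ : Algebra.adjoin A (Set.range x))).mul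
      ((isAlgebraic_algebraMap (⟨s, hs⟩ : Algebra.adjoin A (Set.range x))).inv)
  have hle : lift.{uB} #(Fin S.card) ≤ lift.{0} (Algebra.trdeg A B) := by
    have hfin : Algebra.trdeg A B < ℵ₀ := by
      have h1 : lift.{uA} (Algebra.trdeg A B) ≤ lift.{uA} (n : Cardinal.{uB}) := by
        rw [← h]; exact self_le_add_left _ _
      have := (Cardinal.lift_le.1 h1)
      exact this.trans_lt (Cardinal.natCast_lt_aleph0)
    obtain ⟨d, hd⟩ := Cardinal.lt_aleph0.1 hfin
    rw [hd] at h ⊢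
    simp only [Cardinal.lift_natCast, Cardinal.mk_fin] at h ⊢
    norm_cast at h ⊢
    omega
  have hb := Algebra.IsAlgebraic.isTranscendenceBasis_of_lift_le_trdeg_of_finite A x hle
  refine ⟨S.card, ⟨?_⟩⟩
  have htop : IntermediateField.adjoin A (Set.range x) = ⊤ := by rw [hx, hS]
  exact (IntermediateField.topEquiv.symm.trans (IntermediateField.equivOfEq htop.symm)).trans hb.1.aevalEquivField.symm

theorem adjoin_top_of {K A B : Type*} [Field K] [Field A] [Field B] [Algebra K A] [Algebra K B]
    [Algebra A B] [IsScalarTower K A B] (S : Set B)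
    (hS : IntermediateField.adjoin K (Set.range (algebraMap A B) ∪ S) = ⊤) :
    IntermediateField.adjoin A S = ⊤ := by
  have : IntermediateField.adjoin K (Set.range (algebraMap A B) ∪ S) ≤ (IntermediateField.adjoin A S).restrictScalars K := by
    rw [IntermediateField.adjoin_le_iff]
    rintro x (⟨a, rfl⟩ | hx)
    · exact (IntermediateField.adjoin A S).algebraMap_mem a
    · exact IntermediateField.subset_adjoin A S hx
  rw [eq_top_iff]
  rintro x -
  apply this
  rw [hS]; trivial

theorem trdeg_big (K : Type uK) [Field K] (G : Type uG) [Finite G] :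
    Algebra.trdeg K (NoetherBigField K G) = (Nat.card G : Cardinal) := by
  have h := trdeg_add_eq K (MvPolynomial G K) (A := NoetherBigField K G)
  have hz : Algebra.trdeg (MvPolynomial G K) (NoetherBigField K G) = 0 := by
    have : Algebra.IsAlgebraic (MvPolynomial G K) (NoetherBigField K G) := IsLocalization.isAlgebraic _ (nonZeroDivisors (MvPolynomial G K))
    exact trdeg_eq_zero
  rw [hz, add_zero, MvPolynomial.trdeg_of_isDomain] at h
  rw [← h]
  haveI := Fintype.ofFinite G
  rw [Cardinal.mk_fintype, Nat.card_eq_fintype_card]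
  simp

theorem trdeg_fix {K E G : Type*} [Field K] [Field E] [Algebra K E] [Group G] [Finite G] (ρ : G →* (E ≃ₐ[K] E)) :
    Algebra.trdeg K (nnFix ρ) = Algebra.trdeg K E := by
  have halg : ∀ Q : IntermediateField K E, Q = ⊤ ⊓ nnFix ρ → Algebra.IsAlgebraic Q E := by
    rintro Q rfl
    exact ⟨fun x => (nn_integral ρ ⊤ (fun _ _ _ => trivial) x trivial).isAlgebraic⟩
  have := halg (nnFix ρ) (by simp)
  have h := trdeg_add_eq K (nnFix ρ) (A := E)
  rwa [trdeg_eq_zero (R := nnFix ρ) (A := E), add_zero] at h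

theorem trdeg_noether (K : Type uK) [Field K] (G : Type uG) [Group G] [Finite G] :
    Algebra.trdeg K (NoetherField K G) = (Nat.card G : Cardinal) := by
  have v : NoetherField K G →ₐ[K] nnFix (nrho K G) :=
    (nval K G).codRestrict (nnFix (nrho K G)).toSubalgebra (nval_mem K)
  let e : nnFix (nrho K G) →ₐ[K] NoetherField K G :=
   { toFun := fun x => nmk K x.1 x.2
     map_one' := rfl
     map_mul' := fun _ _ => rfl
     map_zero' := rfl
     map_add' := fun _ _ => rfl
     commutes' := fun _ => rfl }
  have h1 := trdeg_le_of_injective v v.toRingHom.injective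
  have h2 := trdeg_le_of_injective e e.toRingHom.injective
  rw [trdeg_fix, trdeg_big] at h1 h2
  exact le_antisymm h1 h2

theorem NP_final (K : Type*) [Field K] (Gt G : Type*) [Group Gt] [Group G] [Finite Gt] [Finite G] (h : NP K Gt G) :
    ∃ ι : NoetherField K G →ₐ[K] NoetherField K Gt,
      @IsRationalExtension (NoetherField K G) (NoetherField K Gt) _ _
        ι.toRingHom.toAlgebra := by
  obtain ⟨ι, S, hc, hS⟩ := h
  refine ⟨ι, ?_⟩
  letI := ι.toRingHom.toAlgebra
  haveI : IsScalarTower K (NoetherField K G) (NoetherField K Gt) :=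
    IsScalarTower.of_algebraMap_eq fun x => (ι.commutes x).symm
  exact rational_of_gen (K := K) S (adjoin_top_of (K := K) _ hS) _ _ (trdeg_noether K G) (trdeg_noether K Gt) hc

end FF
end

noncomputable section
section EE
open IntermediateField

theorem step_field {K E Gt G : Type*} [Field K] [Field E] [Algebra K E] [Group Gt] [Group G] [Fintype Gt]
    [Fintype G] [DecidableEq G] [DecidableEq Gt] [DecidableEq E]
    (p : ℕ) [Fact p.Prime] [CharP E p] (ρ : Gt →* (E ≃ₐ[K] E))
    (π : Gt →* G) (s : G → Gt) (hs : ∀ g, π (s g) = g) (lam : Gt → ZMod p) (hlams : ∀ g, lam (s g) = 0)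
    (hlam : ∀ h ∈ π.ker, ∀ g, lam (h * g) = lam h + lam g)
    (hlam0 : ∀ h ∈ π.ker, lam h = 0 → h = 1) (h1 : Gt) (h1k : h1 ∈ π.ker) (h1l : lam h1 = 1)
    (hchi : ∀ k : Gt, ∃ χ : ZMod p, ∀ h ∈ π.ker, lam (k⁻¹ * h * k) = χ * lam h)
    (x : Gt → E) (hx : ∀ k g, ρ k (x g) = x (k * g)) (hxtop : adjoin K (Set.range x) = ⊤)
    (L : IntermediateField K E) (hL : ∀ g, ∀ a ∈ L, ρ g a ∈ L)
    (hz : ∀ g : G, (∑ a : Gt with π a = g, x a) ∈ L)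
    (hN : ∀ g ∈ π.ker, ∀ a ∈ L, ρ g a = a) (hN' : ∀ g ∉ π.ker, ∃ a ∈ L, ρ g a ≠ a)
    (hSig : ∑ g, x g ≠ 0) :
    ∃ S : Finset E, S.card + Fintype.card G ≤ Fintype.card Gt ∧ (∀ a ∈ S, a ∈ nnFix ρ) ∧
      nnFix ρ ≤ (L ⊓ nnFix ρ) ⊔ adjoin K (S : Set E) := by
  set φ : ZMod p →+* E := ZMod.castHom (dvd_refl p) E with hφ
  have hφn : ∀ a : ZMod p, φ a = ((a.val : ℕ) : E) := by
    intro a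
    conv_lhs => rw [← ZMod.natCast_zmod_val a]
    rw [map_natCast]
  have hφL : ∀ (M : IntermediateField K E) (a : ZMod p), φ a ∈ M := by
    intro M a; rw [hφn]; exact _root_.natCast_mem M _
  have hρφ : ∀ k a, ρ k (φ a) = φ a := by
    intro k a; rw [hφn, map_natCast]
  set y : E := ∑ g, φ (lam g) * x g with hy
  set Sg : E := ∑ g, x g with hSg
  have hSgL : Sg ∈ L := by
    rw [hSg, ← Finset.sum_fiberwise Finset.univ π x]
    exact sum_mem fun g _ => hz g
  have hρS : ∀ k, ρ k Sg = Sg := by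
    intro k
    rw [hSg, map_sum]
    simp only [hx]
    exact Fintype.sum_equiv (Equiv.mulLeft k) _ _ (fun g => rfl)
  have hρy : ∀ k, ρ k y = ∑ g, φ (lam (k⁻¹ * g)) * x g := by
    intro k
    rw [hy, map_sum]
    refine Fintype.sum_equiv (Equiv.mulLeft k) _ _ (fun g => ?_)
    simp [hx, hρφ]
  have hker : ∀ h ∈ π.ker, ρ h y = y + φ (lam h⁻¹) * Sg := by
    intro h hh
    rw [hρy, hy, hSg, Finset.mul_sum, ← Finset.sum_add_distrib]
    refine Finset.sum_congr rfl fun g _ => ?_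
    rw [hlam _ (inv_mem hh), map_add]; ring
  have hsplit : ∀ g : Gt, ∃ h ∈ π.ker, g = h * s (π g) := by
    intro g
    refine ⟨g * (s (π g))⁻¹, ?_, by simp⟩
    rw [MonoidHom.mem_ker, map_mul, map_inv, hs, mul_inv_cancel]
  have hgen : ∀ k, ∃ χ : ZMod p, ρ k y - φ χ * y ∈ L := by
    intro k
    obtain ⟨χ, hχ⟩ := hchi k
    refine ⟨χ, ?_⟩
    have hinv : ∀ g, lam (k⁻¹ * g) - χ * lam g = lam (k⁻¹ * s (π g)) := by
      intro g
      obtain ⟨h, hh, hg⟩ := hsplit g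
      have e1 : lam g = lam h := by
        rw [hg, hlam h hh, hlams, add_zero]
      have e2 : k⁻¹ * g = (k⁻¹ * h * k) * (k⁻¹ * s (π g)) := by
        conv_lhs => rw [hg]
        group
      have hkk : k⁻¹ * h * k ∈ π.ker := by
        rw [MonoidHom.mem_ker] at hh ⊢
        rw [map_mul, map_mul, hh, map_inv]; simp
      rw [e1, e2, hlam _ hkk, hχ h hh]; ring
    have : ρ k y - φ χ * y = ∑ g : G, φ (lam (k⁻¹ * s g)) * ∑ a : Gt with π a = g, x a := by
      rw [hρy, hy, Finset.mul_sum, ← Finset.sum_sub_distrib, ← Finset.sum_fiberwise Finset.univ π]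
      refine Finset.sum_congr rfl fun g _ => ?_
      rw [Finset.mul_sum]
      refine Finset.sum_congr rfl fun a ha => ?_
      have ha' : π a = g := by simpa using ha
      rw [← ha', ← hinv a, map_sub, map_mul]; ring
    rw [this]
    exact sum_mem fun g _ => mul_mem (hφL L _) (hz g)
  set u : E := y / Sg with hu
  have hyu : y = u * Sg := by rw [hu]; field_simp
  have huker : ∀ h ∈ π.ker, ρ h u = u + φ (lam h⁻¹) := by
    intro h hh
    rw [hu, map_div₀, hker h hh, hρS]; field_simp
  have hugen : ∀ k, ∃ χ : ZMod p, ρ k u - φ χ * u ∈ L := by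
    intro k
    obtain ⟨χ, hχ⟩ := hgen k
    refine ⟨χ, ?_⟩
    have : ρ k u - φ χ * u = (ρ k y - φ χ * y) / Sg := by
      rw [hu, map_div₀, hρS]; field_simp
    rw [this]
    exact div_mem hχ hSgL
  have hlam1 : lam 1 = 0 := by
    have := hlam 1 (one_mem _) 1
    rw [mul_one] at this
    simpa using this
  obtain ⟨S₁, hS₁c, hS₁f, hS₁⟩ := as_main ρ p L hL π.ker hN hN' u
    (fun k => by
      obtain ⟨χ, hχ⟩ := hugen k
      exact ⟨χ.val, by rw [← hφn]; exact hχ⟩)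
    (fun h hh => ⟨(lam h⁻¹).val, by rw [← hφn]; exact huker h hh⟩)
    h1⁻¹ (inv_mem h1k) (by rw [huker _ (inv_mem h1k), inv_inv, h1l, map_one])
  set F : IntermediateField K E := L ⊔ adjoin K {u} with hF
  have hLF : L ≤ F := le_sup_left
  have huF : u ∈ F := (le_sup_right : adjoin K {u} ≤ F) (mem_adjoin_simple_self K u)
  have hFst : ∀ g, ∀ a ∈ F, ρ g a ∈ F := by
    intro g
    have : F ≤ F.comap (ρ g : E →ₐ[K] E) := by
      rw [hF]
      refine sup_le (fun a ha => ?_) ?_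
      · exact hLF (hL g a ha)
      · rw [adjoin_le_iff, Set.singleton_subset_iff]
        obtain ⟨χ, hχ⟩ := hugen g
        have : ρ g u = (ρ g u - φ χ * u) + φ χ * u := by ring
        change ρ g u ∈ F
        rw [this]
        exact add_mem (hLF hχ) (mul_mem (hφL F _) huF)
    exact fun a ha => this ha
  set T0 : Finset Gt := Finset.univ.filter (fun g => g ≠ s (π g) ∧ g ≠ h1) with hT0
  set T : Finset E := T0.image x with hT
  set M : Submodule F E := Submodule.span F (insert (1:E) (T : Set E)) with hM
  have hMF : ∀ a ∈ F, a ∈ M := by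
    intro a ha
    have : a = (⟨a, ha⟩ : F) • (1 : E) := by
      rw [Algebra.smul_def, mul_one]; rfl
    rw [this]
    exact M.smul_mem _ (Submodule.subset_span (Set.mem_insert _ _))
  have hMmul : ∀ a ∈ F, ∀ m ∈ M, a * m ∈ M := fun a ha m hm => M.smul_mem ⟨a, ha⟩ hm
  have hMT : ∀ g, g ≠ s (π g) → g ≠ h1 → x g ∈ M := by
    intro g hg hg'
    refine Submodule.subset_span (Set.mem_insert_of_mem _ ?_)
    rw [hT, Finset.coe_image]
    exact ⟨g, by simp [hT0, hg, hg'], rfl⟩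
  have hMh1 : x h1 ∈ M := by
    have e : x h1 = y - ∑ g ∈ Finset.univ.erase h1, φ (lam g) * x g := by
      rw [hy, ← Finset.add_sum_erase _ _ (Finset.mem_univ h1), h1l, map_one]; ring
    rw [e]
    refine sub_mem (hMF _ ?_) (sum_mem fun g hg => ?_)
    · rw [hyu]; exact mul_mem huF (hLF hSgL)
    · by_cases hgs : g = s (π g)
      · rw [hgs, hlams, map_zero, zero_mul]; exact zero_mem _
      · exact hMmul _ (hφL F _) _ (hMT g hgs (Finset.ne_of_mem_erase hg))
  have hMns : ∀ g, g ≠ s (π g) → x g ∈ M := by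
    intro g hg
    by_cases h : g = h1
    · rw [h]; exact hMh1
    · exact hMT g hg h
  have hMall : ∀ g, x g ∈ M := by
    intro g
    by_cases hg : g = s (π g)
    · have e : x g = (∑ a : Gt with π a = π g, x a) - ∑ a ∈ (Finset.univ.filter (fun a => π a = π g)).erase g, x a := by
        rw [← Finset.add_sum_erase _ _ (show g ∈ Finset.univ.filter (fun a => π a = π g) by simp)]; ring
      rw [e]
      refine sub_mem (hMF _ (hLF (hz _))) (sum_mem fun a ha => hMns a ?_)
      have h2 := Finset.mem_erase.1 ha
      have h3 : π a = π g := by simpa using h2.2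
      rw [h3, ← hg]; exact h2.1
    · exact hMns g hg
  obtain ⟨S₂, hS₂c, hS₂f, hS₂⟩ := nn_main ρ F hFst ⊥
    (fun g hg a _ => by rw [Subgroup.mem_bot.1 hg, map_one]; rfl)
    (fun g hg => by
      by_cases hgk : g ∈ π.ker
      · refine ⟨u, huF, ?_⟩
        rw [huker g hgk]
        intro h
        have h0 : φ (lam g⁻¹) = 0 := by simpa using h
        have := hlam0 _ (inv_mem hgk) ((map_eq_zero φ).1 h0)
        exact hg (Subgroup.mem_bot.2 (inv_eq_one.1 this))
      · obtain ⟨a, ha, h⟩ := hN' g hgk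
        exact ⟨a, hLF ha, h⟩)
    T
    (fun g t ht => by
      obtain ⟨a, _, rfl⟩ := Finset.mem_image.1 ht
      rw [hx]; exact hMall _)
    (fun g hg a _ => by rw [Subgroup.mem_bot.1 hg, map_one]; rfl)
  have htop : F ⊔ adjoin K (T : Set E) = ⊤ := by
    rw [eq_top_iff, ← hxtop, adjoin_le_iff]
    rintro _ ⟨g, rfl⟩
    have := hMall g
    rw [hM] at this
    change x g ∈ F ⊔ adjoin K (T : Set E)
    generalize x g = b at this ⊢
    induction this using Submodule.span_induction with
    | mem a ha =>
      rcases ha with rfl | ha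
      · exact one_mem _
      · exact (le_sup_right : _ ≤ F ⊔ adjoin K (T : Set E)) (subset_adjoin K _ ha)
    | zero => exact zero_mem _
    | add a b _ _ ha hb => exact add_mem ha hb
    | smul c a _ ha =>
      rw [Algebra.smul_def]
      exact mul_mem ((le_sup_left : F ≤ F ⊔ adjoin K (T : Set E)) c.2) ha
  rw [htop, top_inf_eq] at hS₂
  have hTc : T.card + Fintype.card G + 1 ≤ Fintype.card Gt := by
    have hd : Disjoint T0 (insert h1 (Finset.univ.image s)) := by
      rw [Finset.disjoint_left]
      intro g hg hg'
      simp only [hT0, Finset.mem_filter, Finset.mem_univ, true_and] at hg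
      rcases Finset.mem_insert.1 hg' with h | h
      · exact hg.2 h
      · obtain ⟨b, _, rfl⟩ := Finset.mem_image.1 h
        exact hg.1 (by rw [hs])
    have hni : h1 ∉ Finset.univ.image s := by
      intro h
      obtain ⟨b, _, hb⟩ := Finset.mem_image.1 h
      rw [← hb, hlams] at h1l
      exact zero_ne_one h1l
    have hsi : Function.Injective s := fun a b h => by rw [← hs a, h, hs]
    have := Finset.card_le_univ (T0 ∪ insert h1 (Finset.univ.image s))
    rw [Finset.card_union_of_disjoint hd, Finset.card_insert_of_notMem hni, Finset.card_image_of_injective _ hsi,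
      Finset.card_univ] at this
    have h2 : T.card ≤ T0.card := Finset.card_image_le
    omega
  refine ⟨S₁ ∪ S₂, ?_, ?_, ?_⟩
  · have := Finset.card_union_le S₁ S₂
    omega
  · intro a ha
    rcases Finset.mem_union.1 ha with h | h
    · exact hS₁f a h
    · exact hS₂f a h
  · refine hS₂.trans (sup_le (hS₁.trans (sup_le le_sup_left ?_)) ?_)
    · exact le_sup_of_le_right (adjoin.mono K _ _ (by simp))
    · exact le_sup_of_le_right (adjoin.mono K _ _ (by simp))

end EE
end

noncomputable section
section GG
open IntermediateField

theorem step_group {Gt G : Type*} [Group Gt] [Group G] [Finite Gt]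
    (p : ℕ) [Fact p.Prime]
    (π : Gt →* G) (hsurj : Function.Surjective π) (hc : Nat.card π.ker = p) :
    ∃ (s : G → Gt) (lam : Gt → ZMod p) (h1 : Gt), (∀ g, π (s g) = g) ∧ (∀ g, lam (s g) = 0) ∧
    (∀ h ∈ π.ker, ∀ g, lam (h * g) = lam h + lam g) ∧
    (∀ h ∈ π.ker, lam h = 0 → h = 1) ∧ h1 ∈ π.ker ∧ lam h1 = 1 ∧
    (∀ k : Gt, ∃ χ : ZMod p, ∀ h ∈ π.ker, lam (k⁻¹ * h * k) = χ * lam h) := by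
  classical
  have hcyc : IsCyclic π.ker := isCyclic_of_prime_card hc
  obtain ⟨e⟩ : Nonempty (Multiplicative (ZMod p) ≃* π.ker) := by
    subst hc; exact ⟨zmodCyclicMulEquiv hcyc⟩
  let l : π.ker → ZMod p := fun h => (e.symm h).toAdd
  have lmul : ∀ a b, l (a * b) = l a + l b := fun a b => by simp [l]
  have l1 : l 1 = 0 := by simp [l]
  have l0 : ∀ a, l a = 0 → a = 1 := fun a h => by
    have : e.symm a = 1 := h
    simpa using this
  have le : ∀ a, l (e (Multiplicative.ofAdd a)) = a := fun a => by simp [l]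
  choose s0 hs0 using hsurj
  let s : G → Gt := fun g => if g = 1 then 1 else s0 g
  have hs : ∀ g, π (s g) = g := by
    intro g
    by_cases h : g = 1 <;> simp [s, h, hs0]
  have s1 : s 1 = 1 := by simp [s]
  have hm : ∀ g, g * (s (π g))⁻¹ ∈ π.ker := by
    intro g
    rw [MonoidHom.mem_ker, map_mul, map_inv, hs, mul_inv_cancel]
  let lam : Gt → ZMod p := fun g => l ⟨g * (s (π g))⁻¹, hm g⟩
  have lamk : ∀ h (hh : h ∈ π.ker), lam h = l ⟨h, hh⟩ := by
    intro h hh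
    simp only [lam]
    congr 1
    ext
    simp [MonoidHom.mem_ker.1 hh, s1]
  have hconj : ∀ k : Gt, ∀ h ∈ π.ker, k⁻¹ * h * k ∈ π.ker := by
    intro k h hh
    rw [MonoidHom.mem_ker] at hh ⊢
    rw [map_mul, map_mul, hh, map_inv]; simp
  refine ⟨s, lam, e (Multiplicative.ofAdd 1), hs, ?_, ?_, ?_, ?_, ?_, ?_⟩
  · intro g
    have : (⟨s g * (s (π (s g)))⁻¹, hm (s g)⟩ : π.ker) = 1 := by ext; simp [hs]
    simp only [lam]
    rw [this, l1]
  · intro h hh g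
    rw [lamk h hh]
    simp only [lam]
    rw [← lmul]
    congr 1
    ext
    simp [MonoidHom.mem_ker.1 hh, mul_assoc]
  · intro h hh h0
    rw [lamk h hh] at h0
    exact congrArg Subtype.val (l0 _ h0)
  · exact (e _).2
  · rw [lamk _ (e _).2]; exact le 1
  · intro k
    let f : ZMod p →+ ZMod p := AddMonoidHom.mk'
      (fun a => l ⟨k⁻¹ * (e (Multiplicative.ofAdd a) : Gt) * k, hconj k _ (e _).2⟩) (by
        intro a b
        rw [← lmul]
        congr 1
        ext
        simp [mul_assoc])
    refine ⟨f 1, fun h hh => ?_⟩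
    have h2 := ZMod.map_smul f (l ⟨h, hh⟩) 1
    rw [smul_eq_mul, mul_one, smul_eq_mul] at h2
    rw [lamk _ (hconj k h hh), lamk h hh, mul_comm, ← h2]
    have : e (Multiplicative.ofAdd (l ⟨h, hh⟩)) = ⟨h, hh⟩ := by simp [l]
    simp only [f, AddMonoidHom.mk'_apply, this]

theorem nx_inj (K G : Type*) [Field K] : Function.Injective (nx K : G → NoetherBigField K G) :=
  (IsFractionRing.injective (MvPolynomial G K) (NoetherBigField K G)).comp (MvPolynomial.X_injective)

theorem nsum_ne (K G : Type*) [Field K] [Group G] [Fintype G] : ∑ g : G, nx K g ≠ 0 := by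
  classical
  unfold nx
  rw [← map_sum, Ne, map_eq_zero_iff _ (IsFractionRing.injective (MvPolynomial G K) (NoetherBigField K G))]
  intro h
  have := congrArg (MvPolynomial.eval (fun g : G => if g = 1 then (1 : K) else 0)) h
  simp at this

theorem step_NP (K : Type*) [Field K] (p : ℕ) [Fact p.Prime] [CharP K p]
    {Gt G : Type*} [Group Gt] [Group G] [Finite Gt]
    (π : Gt →* G) (hsurj : Function.Surjective π) (hc : Nat.card π.ker = p) : NP K Gt G := by
  classical
  have : Finite G := Finite.of_surjective π hsurj
  haveI := Fintype.ofFinite Gt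
  haveI := Fintype.ofFinite G
  haveI : CharP (NoetherBigField K Gt) p := charP_of_injective_algebraMap
    (algebraMap K (NoetherBigField K Gt)).injective p
  obtain ⟨s, lam, h1, hs, hlams, hlam, hlam0, h1k, h1l, hchi⟩ := step_group p π hsurj hc
  have hinj : Function.Injective (npull K π hsurj) := (npull K π hsurj).toRingHom.injective
  obtain ⟨S, hSc, hSf, hS⟩ := step_field p (nrho K Gt) π s hs lam hlams hlam hlam0 h1 h1k h1l hchi
    (nx K) (nrho_nx K) (nx_adjoin K Gt) (npull K π hsurj).fieldRange
    (by
      rintro g _ ⟨a, rfl⟩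
      refine ⟨nrho K G (π g) a, ?_⟩
      exact (npull_equivariant K π hsurj g a).symm)
    (fun g => ⟨nx K g, npull_nx K π hsurj g⟩)
    (by
      rintro g hg _ ⟨a, rfl⟩
      refine (npull_equivariant K π hsurj g a).trans ?_
      rw [MonoidHom.mem_ker.1 hg, map_one]
      rfl)
    (by
      intro g hg
      refine ⟨npull K π hsurj (nx K 1), ⟨nx K 1, rfl⟩, fun h => hg ?_⟩
      rw [npull_equivariant, nrho_nx, mul_one] at h
      exact MonoidHom.mem_ker.2 (nx_inj K G (hinj h)))
    (nsum_ne K Gt)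
  exact NP_mk K π hsurj S (by rw [Nat.card_eq_fintype_card, Nat.card_eq_fintype_card]; exact hSc) hSf hS

theorem base_NP (K : Type*) [Field K]
    {Gt G : Type*} [Group Gt] [Group G] [Finite Gt]
    (π : Gt →* G) (hsurj : Function.Surjective π) (hc : Nat.card π.ker = 1) : NP K Gt G := by
  classical
  haveI := Fintype.ofFinite Gt
  have hi : Function.Injective π := by
    rw [← MonoidHom.ker_eq_bot_iff]; exact Subgroup.eq_bot_of_card_eq _ hc
  refine NP_mk K π hsurj ∅ ?_ (by simp) ?_
  · rw [Nat.card_congr (Equiv.ofBijective π ⟨hi, hsurj⟩)]; simp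
  · have : (npull K π hsurj).fieldRange = ⊤ := by
      rw [eq_top_iff, ← nx_adjoin K Gt, adjoin_le_iff]
      rintro _ ⟨a, rfl⟩
      refine ⟨nx K (π a), (npull_nx K π hsurj _).trans ?_⟩
      rw [Finset.sum_eq_single a]
      · intro b hb hba
        exact (hba (hi (by simpa using hb))).elim
      · simp
    rw [this, top_inf_eq]
    exact le_sup_left

theorem all_NP (K : Type*) [Field K] (p : ℕ) [Fact p.Prime] [CharP K p] {G : Type*} [Group G] (n : ℕ) :
    ∀ (Gt : Type*) [Group Gt] [Finite Gt]
    (π : Gt →* G) (hsurj : Function.Surjective π) (hpk : IsPGroup p π.ker) (hcyc : IsCyclic π.ker)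
    (hn : Nat.card π.ker = n), NP K Gt G := by
  induction n using Nat.strong_induction_on with
  | _ n ih =>
  intro Gt _ _ π hsurj hpk hcyc hn
  classical
  by_cases h1 : n = 1
  · exact base_NP K π hsurj (hn.trans h1)
  have hcomm : ∀ a b : π.ker, a * b = b * a := by
    letI := IsCyclic.commGroup (α := π.ker)
    exact mul_comm
  have hcommG : ∀ a ∈ π.ker, ∀ b ∈ π.ker, a * b = b * a := fun a ha b hb =>
    congrArg Subtype.val (hcomm ⟨a, ha⟩ ⟨b, hb⟩)
  let H1 : Subgroup Gt :=
    { carrier := {h | h ∈ π.ker ∧ h ^ p = 1}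
      one_mem' := ⟨one_mem _, one_pow _⟩
      mul_mem' := by
        rintro a b ⟨ha, ha'⟩ ⟨hb, hb'⟩
        refine ⟨mul_mem ha hb, ?_⟩
        have : Commute a b := hcommG a ha b hb
        rw [this.mul_pow, ha', hb', one_mul]
      inv_mem' := by
        rintro a ⟨ha, ha'⟩
        exact ⟨inv_mem ha, by rw [inv_pow, ha', inv_one]⟩ }
  have hH1 : ∀ h, h ∈ H1 ↔ h ∈ π.ker ∧ h ^ p = 1 := fun h => Iff.rfl
  have hH1le : H1 ≤ π.ker := fun h hh => hh.1
  haveI : H1.Normal := ⟨by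
    rintro h ⟨hh, hh'⟩ g
    refine ⟨(MonoidHom.normal_ker π).conj_mem h hh g, ?_⟩
    rw [conj_pow, hh']; simp⟩
  have hp : p.Prime := Fact.out
  have hcard : Nat.card H1 = p := by
    haveI := Fintype.ofFinite π.ker
    have hle : Nat.card H1 ≤ p := by
      have h := IsCyclic.card_pow_eq_one_le (α := π.ker) (n := p) hp.pos
      refine le_trans ?_ h
      rw [← Fintype.card_coe, ← Nat.card_eq_fintype_card]
      refine Nat.card_le_card_of_injective (fun a => ⟨⟨a.1, a.2.1⟩, ?_⟩) ?_
      · simp only [Finset.mem_filter, Finset.mem_univ, true_and]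
        exact Subtype.ext a.2.2
      · intro a b hab
        exact Subtype.ext (congrArg (fun z => (z.1.1 : Gt)) hab)
    have hge : p ∣ Nat.card H1 := by
      haveI : Nontrivial π.ker := by
        rw [← Finite.one_lt_card_iff_nontrivial]
        have : 0 < Nat.card π.ker := Nat.card_pos
        omega
      obtain ⟨m, hm, hm'⟩ := hpk.nontrivial_iff_card.1 this
      obtain ⟨a, ha⟩ := exists_prime_orderOf_dvd_card' (G := π.ker) p (by rw [hm']; exact dvd_pow_self p hm.ne')
      have haG : orderOf (a : Gt) = p := by rw [← ha]; exact Subgroup.orderOf_coe a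
      have ha1 : (a : Gt) ∈ H1 := ⟨a.2, by rw [← haG]; exact pow_orderOf_eq_one _⟩
      rw [← haG, ← Subgroup.orderOf_mk _ ha1]
      exact orderOf_dvd_natCard _
    exact le_antisymm hle (Nat.le_of_dvd Nat.card_pos hge)
  have s1 : NP K Gt (Gt ⧸ H1) := step_NP K p (QuotientGroup.mk' H1) (QuotientGroup.mk'_surjective H1) (by
    rw [QuotientGroup.ker_mk']; exact hcard)
  let π' : Gt ⧸ H1 →* G := QuotientGroup.lift H1 π hH1le
  have hπ' : Function.Surjective π' := fun g => by
    obtain ⟨a, rfl⟩ := hsurj g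
    exact ⟨QuotientGroup.mk a, rfl⟩
  let f : π.ker →* π'.ker := ((QuotientGroup.mk' H1).comp π.ker.subtype).codRestrict π'.ker (fun a => a.2)
  have hf : Function.Surjective f := by
    rintro ⟨b, hb⟩
    obtain ⟨a, rfl⟩ := QuotientGroup.mk'_surjective H1 b
    exact ⟨⟨a, hb⟩, rfl⟩
  refine NP_trans K s1 (ih (Nat.card π'.ker) ?_ _ π' hπ' (hpk.of_surjective f hf) (isCyclic_of_surjective f hf) rfl)
  have hcG := Subgroup.card_mul_index π.ker
  have hcQ := Subgroup.card_mul_index π'.ker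
  have hcH := Subgroup.card_eq_card_quotient_mul_card_subgroup H1
  rw [Subgroup.index_ker, MonoidHom.range_eq_top.2 hsurj] at hcG
  rw [Subgroup.index_ker, MonoidHom.range_eq_top.2 hπ'] at hcQ
  rw [← hcG, ← hcQ, hcard, hn] at hcH
  haveI : Finite G := Finite.of_surjective π hsurj
  have hG : 0 < Nat.card (⊤ : Subgroup G) := Nat.card_pos
  have : n = Nat.card π'.ker * p := by
    apply Nat.eq_of_mul_eq_mul_right hG
    rw [hcH]; ring
  have h3 : 0 < Nat.card π'.ker := Nat.card_pos
  have := hp.two_le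
  nlinarith

theorem mainE (K : Type*) [Field K] (p : ℕ) (hp : p.Prime) [CharP K p]
    (Gt G : Type*) [Group Gt] [Group G] [Finite Gt] [Finite G]
    (π : Gt →* G) (hsurj : Function.Surjective π)
    (hp_ker : IsPGroup p π.ker) (hcyc : IsCyclic π.ker) :
    ∃ ι : NoetherField K G →ₐ[K] NoetherField K Gt,
      @IsRationalExtension (NoetherField K G) (NoetherField K Gt) _ _
        ι.toRingHom.toAlgebra := by
  haveI : Fact p.Prime := ⟨hp⟩
  exact NP_final K Gt G (all_NP K p _ Gt π hsurj hp_ker hcyc rfl)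

end GG
end

/-- Theorem 1.8 (first case): if `char K = p > 0` and `1 → H → G̃ → G → 1` is a group extension
of finite groups with `H` a cyclic `p`-group, then there is a `K`-embedding of `K(G)` into
`K(G̃)` making `K(G̃)` rational over (the image of) `K(G)`. -/
theorem noether_rational_cyclic_p_kernel
    (K : Type*) [Field K] (p : ℕ) (hp : p.Prime) [CharP K p]
    (Gt G : Type*) [Group Gt] [Group G] [Finite Gt] [Finite G]
    (π : Gt →* G) (hsurj : Function.Surjective π)
    (hp_ker : IsPGroup p π.ker) (hcyc : IsCyclic π.ker) :
    ∃ ι : NoetherField K G →ₐ[K] NoetherField K Gt,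
      @IsRationalExtension (NoetherField K G) (NoetherField K Gt) _ _
        ι.toRingHom.toAlgebra := by
  exact mainE K p hp Gt G π hsurj hp_ker hcyc

end
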